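/- Let H ∈ (0,1), let W^H be a fractional Brownian motion with Hurst parameter H, and let Y_t := ∫₀ᵗ W^H_s ds. There exist constants c_H > 0 and φ > 0 such that for every n ∈ ℕ, setting δ_n := c_H · 2^{−n/2} √(n log 2 + 2 log n), one has P( sup_{0 ≤ i ≤ 2^n−1} | 2^{n(2H−3/2)} ‖ϑ̄^Y_{2n,i}‖_{ℓ₂} / √τ_H − 1 | ≥ δ_n ) ≤ φ / n². -/

import Mathlib

open MeasureTheory ProbabilityTheory Filter

/-- Approximated Faber–Schauder coefficient `ϑ^f_{n,k}`. -/
noncomputable def vartheta (f : ℝ → ℝ) (n k : ℕ) : ℝ :=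
  (2 : ℝ) ^ ((3 * (n : ℝ)) / 2 + 3) *
    (f ((4 * k) / 2 ^ (n + 2)) - 2 * f ((4 * k + 1) / 2 ^ (n + 2))
      + 2 * f ((4 * k + 3) / 2 ^ (n + 2)) - f ((4 * k + 4) / 2 ^ (n + 2)))

/-- Squared Euclidean norm of the block `ϑ̄^f_{2n,i}`. -/
noncomputable def blockNormSq (f : ℝ → ℝ) (n i : ℕ) : ℝ :=
  ∑ j ∈ Finset.range (2 ^ n), (vartheta f (2 * n) (2 ^ n * i + j)) ^ 2

/-- `δ_n := c_H 2^{-n/2} √(n log 2 + 2 log n)`. -/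
noncomputable def deltaSeq (cH : ℝ) (n : ℕ) : ℝ :=
  cH * (2 : ℝ) ^ (-(n : ℝ) / 2) * Real.sqrt ((n : ℝ) * Real.log 2 + 2 * Real.log n)

/-- Covariance function of fractional Brownian motion with Hurst parameter `H`. -/
noncomputable def fbmCov (H s t : ℝ) : ℝ :=
  (s ^ (2 * H) + t ^ (2 * H) - |s - t| ^ (2 * H)) / 2

/-- `W` is a fractional Brownian motion with Hurst parameter `H` on `[0,1]`:
it has a.s. continuous paths and centered Gaussian finite-dimensional distributions
with covariance `fbmCov H`. -/
def IsFBM {Ω : Type*} [MeasurableSpace Ω] (P : Measure Ω) (H : ℝ) (W : ℝ → Ω → ℝ) : Prop :=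
  (∀ t, Measurable (W t)) ∧
  (∀ᵐ ω ∂P, ContinuousOn (fun t => W t ω) (Set.Icc 0 1)) ∧
  ∀ (n : ℕ) (t c : Fin n → ℝ), (∀ i, t i ∈ Set.Icc (0 : ℝ) 1) →
    Measure.map (fun ω => ∑ i, c i * W (t i) ω) P =
      gaussianReal 0 (Real.toNNReal (∑ i, ∑ j, c i * c j * fbmCov H (t i) (t j)))

open scoped Matrix in
/-- The spectral theorem for a real symmetric matrix, with an explicit orthogonal matrix. -/
lemma exists_orthogonal_diagonalization {ι : Type*} [Fintype ι] [DecidableEq ι]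
    {S : Matrix ι ι ℝ} (hS : S.IsSymm) :
    ∃ (U : Matrix ι ι ℝ) (σ : ι → ℝ), Uᵀ * U = 1 ∧ U * Uᵀ = 1 ∧
      S = U * Matrix.diagonal σ * Uᵀ := by
  have hH : S.IsHermitian := by
    rw [Matrix.IsHermitian, Matrix.conjTranspose_eq_transpose_of_trivial]
    exact hS
  have hU : (hH.eigenvectorUnitary : Matrix ι ι ℝ)ᵀ * hH.eigenvectorUnitary = 1 := by
    have := Unitary.coe_star_mul_self hH.eigenvectorUnitary
    rwa [Matrix.star_eq_conjTranspose, Matrix.conjTranspose_eq_transpose_of_trivial] at this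
  refine ⟨hH.eigenvectorUnitary, hH.eigenvalues, hU, mul_eq_one_comm.1 hU, ?_⟩
  have := hH.spectral_theorem
  rw [Unitary.conjStarAlgAut_apply, Matrix.star_eq_conjTranspose,
      Matrix.conjTranspose_eq_transpose_of_trivial] at this
  simpa using this

/-- Exponential moments of the square of a centered Gaussian variable. -/
lemma mgf_sq_gaussianReal (v : NNReal) {l : ℝ} (hl : 2 * l * v < 1) :
    mgf (fun x => x ^ 2) (gaussianReal 0 v) l = (Real.sqrt (1 - 2 * l * v))⁻¹ := by
  by_cases hv : v = 0
  · subst hv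
    simp [mgf]
  have hv' : (0 : ℝ) < v := by positivity
  rw [mgf, integral_gaussianReal_eq_integral_smul hv]
  have h1 : ∀ x : ℝ, gaussianPDFReal 0 v x • Real.exp (l * x ^ 2) =
      (Real.sqrt (2 * Real.pi * v))⁻¹ * Real.exp (-((1 - 2 * l * v) / (2 * v)) * x ^ 2) := by
    intro x
    rw [gaussianPDFReal, smul_eq_mul, mul_assoc, ← Real.exp_add]
    congr 2
    field_simp
    ring
  simp_rw [h1]
  rw [integral_const_mul, integral_gaussian, ← Real.sqrt_inv, ← Real.sqrt_inv,
    ← Real.sqrt_mul (by positivity)]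
  congr 1
  have : 1 - 2 * l * v ≠ 0 := by linarith
  field_simp [Real.pi_ne_zero]

lemma inv_sqrt_one_sub_le_exp {t : ℝ} (ht : |t| ≤ 1 / 4) :
    (Real.sqrt (1 - 2 * t))⁻¹ ≤ Real.exp (t + 2 * t ^ 2) := by
  obtain ⟨h1, h2⟩ := abs_le.1 ht
  have hpos : 0 < 1 - 2 * t := by linarith
  rw [inv_le_iff_one_le_mul₀ (Real.sqrt_pos.2 hpos), ← Real.sqrt_sq (Real.exp_pos _).le,
    ← Real.sqrt_mul (by positivity), Real.one_le_sqrt, sq, ← Real.exp_add]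
  set w := t + 2 * t ^ 2 + (t + 2 * t ^ 2) with hw
  rcases le_total 0 t with h | h
  · refine le_trans ?_ (mul_le_mul_of_nonneg_right
      (Real.quadratic_le_exp_of_nonneg (by rw [hw]; positivity : 0 ≤ w)) hpos.le)
    have h3 : (1 + w + w ^ 2 / 2) * (1 - 2 * t) =
        1 + 2 * t ^ 2 * (1 - 2 * t - 4 * t ^ 2 - 8 * t ^ 3) := by
      rw [hw]; ring
    have h4 : t ^ 2 ≤ 1 / 16 := by nlinarith
    have h5 : t ^ 3 ≤ 1 / 64 := by nlinarith
    rw [h3]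
    exact le_add_of_nonneg_right (mul_nonneg (by positivity) (by linarith))
  · refine le_trans ?_ (mul_le_mul_of_nonneg_right (Real.add_one_le_exp w) hpos.le)
    have h3 : (w + 1) * (1 - 2 * t) = 1 + 8 * t ^ 2 * (-t) := by rw [hw]; ring
    rw [h3]
    exact le_add_of_nonneg_right (mul_nonneg (by positivity) (by linarith))

/-- Exponential moments of the squared norm of a centered Gaussian vector whose covariance matrix
has unit diagonal and row sums bounded by `L`. -/
lemma mgf_sum_sq_gaussian_le {Ω ι : Type*} [MeasurableSpace Ω] {P : Measure Ω}
    [IsProbabilityMeasure P] [Fintype ι] {Z : ι → Ω → ℝ} (hZ : ∀ i, AEMeasurable (Z i) P)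
    {S : Matrix ι ι ℝ} (hS : S.IsSymm) (hpos : ∀ c : ι → ℝ, 0 ≤ c ⬝ᵥ S.mulVec c)
    (hlaw : ∀ c : ι → ℝ, P.map (fun ω => ∑ i, c i * Z i ω) =
      gaussianReal 0 (c ⬝ᵥ S.mulVec c).toNNReal)
    {L : ℝ} (hdiag : ∀ i, S i i = 1) (hrow : ∀ i, ∑ j, |S i j| ≤ L)
    {l : ℝ} (hl : |l| * L ≤ 1 / 4) :
    Integrable (fun ω => Real.exp (l * ∑ i, Z i ω ^ 2)) P ∧
      mgf (fun ω => ∑ i, Z i ω ^ 2) P l ≤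
        Real.exp (l * Fintype.card ι + 2 * l ^ 2 * (L * Fintype.card ι)) := by
  classical
  obtain ⟨U, σ, hUU, hUU', hSU⟩ := exists_orthogonal_diagonalization hS
  have hquad : ∀ t : ι → ℝ, U.mulVec t ⬝ᵥ S.mulVec (U.mulVec t) = ∑ i, σ i * t i ^ 2 := by
    intro t
    have h1 : S.mulVec (U.mulVec t) = U.mulVec ((Matrix.diagonal σ).mulVec t) := by
      rw [hSU, Matrix.mulVec_mulVec, Matrix.mulVec_mulVec, Matrix.mul_assoc, hUU, Matrix.mul_one]
    rw [h1, Matrix.dotProduct_mulVec, Matrix.vecMul_mulVec, hUU, Matrix.vecMul_one]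
    simp only [dotProduct, Matrix.mulVec_diagonal]
    exact Finset.sum_congr rfl fun i _ => by ring
  have hσ0 : ∀ i, 0 ≤ σ i := by
    intro i
    have := hpos (U.mulVec (Pi.single i 1))
    rw [hquad] at this
    simpa [Pi.single_apply] using this
  have htr : ∑ i, σ i = Fintype.card ι := by
    have : S.trace = ∑ i, σ i := by
      rw [hSU, Matrix.trace_mul_comm, ← Matrix.mul_assoc, hUU, Matrix.one_mul,
        Matrix.trace_diagonal]
    rw [← this]
    simp [Matrix.trace, hdiag]
  have hiso : ∀ V : Matrix ι ι ℝ, V.transpose * V = 1 → ∀ t : ι → ℝ,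
      ∑ k, (V.mulVec t k) ^ 2 = ∑ i, t i ^ 2 := by
    intro V hV t
    have h1 : V.mulVec t ⬝ᵥ V.mulVec t = t ⬝ᵥ t := by
      rw [Matrix.dotProduct_mulVec, Matrix.vecMul_mulVec, hV, Matrix.vecMul_one]
    simpa [dotProduct, sq] using h1
  have hsq := hiso U hUU
  have hσL : ∀ i, σ i ≤ L := by
    intro i
    have h1 : σ i = U.mulVec (Pi.single i 1) ⬝ᵥ S.mulVec (U.mulVec (Pi.single i 1)) := by
      rw [hquad]
      simp [Pi.single_apply]
    have h2 := hsq (Pi.single i 1)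
    set u := U.mulVec (Pi.single i 1) with hu
    have h3 : ∑ k, u k ^ 2 = 1 := by
      rw [h2]; simp [Pi.single_apply]
    calc σ i = ∑ j, ∑ k, u j * (S j k * u k) := by
          rw [h1]; simp [dotProduct, Matrix.mulVec, Finset.mul_sum]
      _ ≤ ∑ j, ∑ k, (|S j k| * u j ^ 2 / 2 + |S k j| * u k ^ 2 / 2) := by
          refine Finset.sum_le_sum fun j _ => Finset.sum_le_sum fun k _ => ?_
          have hs : S k j = S j k := hS.apply j k
          rw [hs]
          have h4 : u j * (S j k * u k) ≤ |S j k| * (|u j| * |u k|) := by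
            refine (le_abs_self _).trans (le_of_eq ?_)
            rw [abs_mul, abs_mul]; ring
          have h5 : |u j| * |u k| ≤ (u j ^ 2 + u k ^ 2) / 2 := by
            nlinarith [sq_nonneg (|u j| - |u k|), sq_abs (u j), sq_abs (u k)]
          nlinarith [abs_nonneg (S j k), mul_le_mul_of_nonneg_left h5 (abs_nonneg (S j k))]
      _ = ∑ j, (∑ k, |S j k|) * u j ^ 2 := by
          simp_rw [Finset.sum_add_distrib]
          rw [Finset.sum_comm (f := fun j k => |S k j| * u k ^ 2 / 2), ← Finset.sum_add_distrib]
          refine Finset.sum_congr rfl fun j _ => ?_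
          rw [← Finset.sum_add_distrib, Finset.sum_mul]
          exact Finset.sum_congr rfl fun k _ => by ring
      _ ≤ ∑ j, L * u j ^ 2 := 
          Finset.sum_le_sum fun j _ => mul_le_mul_of_nonneg_right (hrow j) (sq_nonneg _)
      _ = L := by rw [← Finset.mul_sum, h3, mul_one]
  set X : ι → Ω → ℝ := fun i ω => ∑ k, U k i * Z k ω with hX
  have hXm : ∀ i, AEMeasurable (X i) P := fun i => by fun_prop
  have hlin : ∀ (t : ι → ℝ) ω, ∑ i, t i * X i ω = ∑ k, U.mulVec t k * Z k ω := by
    intro t ω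
    simp only [hX, Matrix.mulVec, dotProduct, Finset.mul_sum, Finset.sum_mul]
    rw [Finset.sum_comm]
    exact Finset.sum_congr rfl fun k _ => Finset.sum_congr rfl fun i _ => by ring
  have hXlaw : ∀ t : ι → ℝ, P.map (fun ω => ∑ i, t i * X i ω) =
      gaussianReal 0 (∑ i, σ i * t i ^ 2).toNNReal := by
    intro t
    simp_rw [hlin, hlaw, hquad]
  have hXi : ∀ i, P.map (X i) = gaussianReal 0 (σ i).toNNReal := by
    intro i
    have := hXlaw (Pi.single i 1)
    simpa [Pi.single_apply] using this
  have hind : iIndepFun X P := by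
    rw [iIndepFun_iff_charFun_pi hXm]
    intro t
    have h1 : charFun (P.map (fun ω => WithLp.toLp 2 (fun i => X i ω))) t =
        charFun (P.map (fun ω => ∑ i, t i * X i ω)) 1 := by
      rw [charFun_apply, charFun_apply, integral_map (by fun_prop) (by fun_prop),
        integral_map (by fun_prop) (by fun_prop)]
      congr 1
      ext ω
      simp [PiLp.inner_apply]
    rw [h1, hXlaw, charFun_gaussianReal]
    simp_rw [hXi, charFun_gaussianReal]
    rw [← Complex.exp_sum, Real.coe_toNNReal _
      (Finset.sum_nonneg fun i _ => mul_nonneg (hσ0 i) (sq_nonneg _))]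
    congr 1
    push_cast
    simp only [mul_zero, zero_mul, zero_sub, one_pow, mul_one]
    rw [Finset.sum_neg_distrib, Finset.sum_div]
    refine congrArg Neg.neg (Finset.sum_congr rfl fun i _ => ?_)
    rw [Real.coe_toNNReal _ (hσ0 i)]
  have hXsq : ∀ ω, ∑ i, Z i ω ^ 2 = (∑ i, fun ω => X i ω ^ 2) ω := by
    intro ω
    rw [← hiso U.transpose (by rw [Matrix.transpose_transpose, hUU']) fun i => Z i ω,
      Finset.sum_apply]
    rfl
  have hσl : ∀ i, |l * σ i| ≤ 1 / 4 := fun i => by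
    rw [abs_mul, abs_of_nonneg (hσ0 i)]
    exact (mul_le_mul_of_nonneg_left (hσL i) (abs_nonneg l)).trans hl
  have hmgf1 : ∀ i, mgf (fun ω => X i ω ^ 2) P l = (Real.sqrt (1 - 2 * (l * σ i)))⁻¹ := by
    intro i
    have h1 : mgf (fun ω => X i ω ^ 2) P l = mgf (fun x => x ^ 2) (P.map (X i)) l :=
      (mgf_map (X := fun x : ℝ => x ^ 2) (hXm i)
        (by fun_prop : Measurable fun x : ℝ => Real.exp (l * x ^ 2)).aestronglyMeasurable).symm
    rw [h1, hXi, mgf_sq_gaussianReal]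
    · rw [Real.coe_toNNReal _ (hσ0 i)]
      ring_nf
    · rw [Real.coe_toNNReal _ (hσ0 i)]
      linarith [(abs_le.1 (hσl i)).2]
  have hmgf : mgf (fun ω => ∑ i, Z i ω ^ 2) P l = ∏ i, (Real.sqrt (1 - 2 * (l * σ i)))⁻¹ := by
    simp_rw [hXsq]
    have := (hind.comp (fun _ x => x ^ 2) (fun _ => by fun_prop)).mgf_sum₀ (t := l)
      (fun i => by have := hXm i; simp only [Function.comp_def]; fun_prop) Finset.univ
    refine Eq.trans this ?_
    exact Finset.prod_congr rfl fun i _ => hmgf1 i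
  constructor
  · by_contra hni
    have h0 : mgf (fun ω => ∑ i, Z i ω ^ 2) P l = 0 := integral_undef hni
    rw [hmgf] at h0
    refine absurd h0 (Finset.prod_pos fun i _ => ?_).ne'
    have := (abs_le.1 (hσl i)).2
    exact inv_pos.2 (Real.sqrt_pos.2 (by linarith))
  · rw [hmgf]
    calc ∏ i, (Real.sqrt (1 - 2 * (l * σ i)))⁻¹
        ≤ ∏ i, Real.exp (l * σ i + 2 * (l * σ i) ^ 2) :=
          Finset.prod_le_prod (fun i _ => by positivity)
            fun i _ => inv_sqrt_one_sub_le_exp (hσl i)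
      _ = Real.exp (∑ i, (l * σ i + 2 * (l * σ i) ^ 2)) := (Real.exp_sum _ _).symm
      _ ≤ _ := by
          refine Real.exp_le_exp.2 ?_
          rw [Finset.sum_add_distrib, ← Finset.mul_sum, htr, add_le_add_iff_left, ← htr,
            Finset.mul_sum, Finset.mul_sum]
          refine Finset.sum_le_sum fun i _ => ?_
          have := mul_le_mul_of_nonneg_right (hσL i) (hσ0 i)
          nlinarith [mul_le_mul_of_nonneg_left this (sq_nonneg l)]

/-- Gaussian concentration of the normalized Euclidean norm of a centered Gaussian vector whose
covariance matrix has unit diagonal and row sums bounded by `L`. -/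
lemma measure_norm_gaussian_sub_one_ge_le {Ω ι : Type*} [MeasurableSpace Ω] {P : Measure Ω}
    [IsProbabilityMeasure P] [Fintype ι] [Nonempty ι] {Z : ι → Ω → ℝ}
    (hZ : ∀ i, AEMeasurable (Z i) P)
    {S : Matrix ι ι ℝ} (hS : S.IsSymm) (hpos : ∀ c : ι → ℝ, 0 ≤ c ⬝ᵥ S.mulVec c)
    (hlaw : ∀ c : ι → ℝ, P.map (fun ω => ∑ i, c i * Z i ω) =
      gaussianReal 0 (c ⬝ᵥ S.mulVec c).toNNReal)
    {L : ℝ} (hL : 0 < L) (hdiag : ∀ i, S i i = 1) (hrow : ∀ i, ∑ j, |S i j| ≤ L)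
    {d : ℝ} (hd : 0 ≤ d) :
    P.real {ω | d ≤ |Real.sqrt ((∑ i, Z i ω ^ 2) / Fintype.card ι) - 1|} ≤
      2 * Real.exp (-(Fintype.card ι * d ^ 2 / (8 * L))) := by
  set N : ℝ := ((Fintype.card ι : ℕ) : ℝ) with hN
  have hN0 : 0 < N := by rw [hN]; exact_mod_cast Fintype.card_pos
  set Q : Ω → ℝ := fun ω => ∑ i, Z i ω ^ 2 with hQ
  have hQ0 : ∀ ω, 0 ≤ Q ω := fun ω => Finset.sum_nonneg fun i _ => sq_nonneg _
  have hsub : {ω | d ≤ |Real.sqrt (Q ω / N) - 1|} ⊆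
      {ω | N * (1 + d) ^ 2 ≤ Q ω} ∪ {ω | d ≤ 1 ∧ Q ω ≤ N * (1 - d)} := by
    intro ω hω
    have hs0 := Real.sqrt_nonneg (Q ω / N)
    have hs2 : Real.sqrt (Q ω / N) ^ 2 * N = Q ω := by
      rw [Real.sq_sqrt (div_nonneg (hQ0 ω) hN0.le)]
      field_simp
    simp only [Set.mem_ofPred_eq] at hω
    rcases le_abs.1 hω with h | h
    · left
      simp only [Set.mem_ofPred_eq]
      rw [← hs2, mul_comm]
      gcongr
      linarith
    · right
      refine ⟨by linarith, ?_⟩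
      rw [← hs2, mul_comm]
      gcongr
      nlinarith
  have hup : P.real {ω | N * (1 + d) ^ 2 ≤ Q ω} ≤ Real.exp (-(N * d ^ 2 / (8 * L))) := by
    set l : ℝ := min d 1 / (4 * L) with hl
    have hm0 : 0 ≤ min d 1 := le_min hd zero_le_one
    have hl0 : 0 ≤ l := by positivity
    have hlL : l * L = min d 1 / 4 := by rw [hl]; field_simp
    obtain ⟨hint, hmgf⟩ := mgf_sum_sq_gaussian_le hZ hS hpos hlaw hdiag hrow (l := l) (by
      rw [abs_of_nonneg hl0, hlL]
      linarith [min_le_right d 1])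
    refine (measure_ge_le_exp_mul_mgf _ hl0 hint).trans ?_
    refine (mul_le_mul_of_nonneg_left hmgf (Real.exp_pos _).le).trans ?_
    rw [← Real.exp_add]
    refine Real.exp_le_exp.2 ?_
    rw [← hN]
    have h1 : -l * (N * (1 + d) ^ 2) + (l * N + 2 * l ^ 2 * (L * N)) =
        -(N / (8 * L)) * (2 * min d 1 * (2 * d + d ^ 2) - min d 1 ^ 2) := by
      rw [hl]; field_simp; ring
    have h2 : -(N * d ^ 2 / (8 * L)) = -(N / (8 * L)) * d ^ 2 := by ring
    rw [h1, h2, neg_mul, neg_mul, neg_le_neg_iff]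
    refine mul_le_mul_of_nonneg_left ?_ (by positivity)
    rcases le_total d 1 with h | h
    · rw [min_eq_left h]; nlinarith [pow_nonneg hd 3]
    · rw [min_eq_right h]; nlinarith
  have hlow : P.real {ω | d ≤ 1 ∧ Q ω ≤ N * (1 - d)} ≤ Real.exp (-(N * d ^ 2 / (8 * L))) := by
    by_cases hd1 : d ≤ 1
    · simp only [hd1, true_and]
      set l : ℝ := -(d / (4 * L)) with hl
      have hl0 : l ≤ 0 := by
        have : 0 ≤ d / (4 * L) := by positivity
        linarith
      obtain ⟨hint, hmgf⟩ := mgf_sum_sq_gaussian_le hZ hS hpos hlaw hdiag hrow (l := l) (by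
        rw [abs_of_nonpos hl0, hl, neg_neg]
        have : d / (4 * L) * L = d / 4 := by field_simp
        rw [this]; linarith)
      refine (measure_le_le_exp_mul_mgf _ hl0 hint).trans ?_
      refine (mul_le_mul_of_nonneg_left hmgf (Real.exp_pos _).le).trans ?_
      rw [← Real.exp_add]
      refine Real.exp_le_exp.2 (le_of_eq ?_)
      rw [← hN, hl]; field_simp; ring
    · simp only [hd1, false_and, Set.ofPred_false, measureReal_empty]
      positivity
  calc P.real {ω | d ≤ |Real.sqrt (Q ω / N) - 1|}
      ≤ P.real ({ω | N * (1 + d) ^ 2 ≤ Q ω} ∪ {ω | d ≤ 1 ∧ Q ω ≤ N * (1 - d)}) :=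
        measureReal_mono hsub
    _ ≤ _ := (measureReal_union_le _ _).trans (by linarith)

/-- The autocorrelation of the weights `(1, -2, 0, 2, -1)` applied to `|·| ^ b`. -/
noncomputable def weightCorr (b x : ℝ) : ℝ :=
  10 * |x| ^ b - 4 * (|x + 1| ^ b + |x - 1| ^ b) - 4 * (|x + 2| ^ b + |x - 2| ^ b)
    + 4 * (|x + 3| ^ b + |x - 3| ^ b) - (|x + 4| ^ b + |x - 4| ^ b)

lemma weightCorr_neg (b x : ℝ) : weightCorr b (-x) = weightCorr b x := by
  have h : ∀ r : ℝ, |-x + r| = |x - r| := fun r => by rw [← abs_neg]; ring_nf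
  have h' : ∀ r : ℝ, |-x - r| = |x + r| := fun r => by rw [← abs_neg]; ring_nf
  simp only [weightCorr, h, h', abs_neg]
  ring

lemma weightCorr_zero_pos {b : ℝ} (hb : b ∈ Set.Ioo (2 : ℝ) 4) : 0 < weightCorr b 0 := by
  have key : StrictConvexOn ℝ Set.univ
      (fun b : ℝ => 4 * (1 / 3 : ℝ) ^ b + (4 * (2 / 3 : ℝ) ^ b + (4 / 3 : ℝ) ^ b)) := by
    have h : ∀ r : ℝ, 0 < r → r ≠ 1 → StrictConvexOn ℝ Set.univ (fun b : ℝ => r ^ b) := by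
      intro r hr hr1
      refine ⟨convex_univ, fun x _ y _ hxy p q hp hq hpq => ?_⟩
      have hlog : Real.log r ≠ 0 := Real.log_ne_zero_of_pos_of_ne_one hr hr1
      have h := strictConvexOn_exp.2 (Set.mem_univ (Real.log r * x))
        (Set.mem_univ (Real.log r * y)) (fun h => hxy (mul_left_cancel₀ hlog h)) hp hq hpq
      simp only [Real.rpow_def_of_pos hr]
      convert h using 2
      simp only [smul_eq_mul]
      ring
    have h4 : ∀ r : ℝ, 0 < r → r ≠ 1 → StrictConvexOn ℝ Set.univ (fun b : ℝ => 4 * r ^ b) := by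
      intro r hr hr1
      have h1 := h r hr hr1
      have h2 := (h1.add h1).add (h1.add h1)
      refine h2.congr fun x _ => ?_
      simp only [Pi.add_apply]
      ring
    exact (h4 _ (by norm_num) (by norm_num)).add
      ((h4 _ (by norm_num) (by norm_num)).add (h _ (by norm_num) (by norm_num)))
  have h24 := key.2 (Set.mem_univ 2) (Set.mem_univ 4) (by norm_num)
    (show 0 < (4 - b) / 2 by linarith [hb.2]) (show 0 < (b - 2) / 2 by linarith [hb.1]) (by ring)
  have hbb : ((4 - b) / 2) • (2 : ℝ) + ((b - 2) / 2) • (4 : ℝ) = b := by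
    simp only [smul_eq_mul]; ring
  have e2 : 4 * (1 / 3 : ℝ) ^ (2 : ℝ) + (4 * (2 / 3 : ℝ) ^ (2 : ℝ) + (4 / 3 : ℝ) ^ (2 : ℝ)) =
      4 := by
    norm_num
  have e4 : 4 * (1 / 3 : ℝ) ^ (4 : ℝ) + (4 * (2 / 3 : ℝ) ^ (4 : ℝ) + (4 / 3 : ℝ) ^ (4 : ℝ)) =
      4 := by
    norm_num
  simp only at h24
  rw [hbb, e2, e4, smul_eq_mul, smul_eq_mul] at h24
  have h3 : (0 : ℝ) < 3 ^ b := by positivity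
  have h5 : weightCorr b 0 = 2 * 3 ^ b *
      (4 - (4 * (1 / 3 : ℝ) ^ b + (4 * (2 / 3 : ℝ) ^ b + (4 / 3 : ℝ) ^ b))) := by
    have hz : (0 : ℝ) ^ b = 0 := Real.zero_rpow (by linarith [hb.1])
    rw [Real.div_rpow (by norm_num) (by norm_num), Real.div_rpow (by norm_num) (by norm_num),
      Real.div_rpow (by norm_num) (by norm_num)]
    simp [weightCorr, hz]
    field_simp
    ring
  rw [h5]
  exact mul_pos (by positivity) (by linarith)

/-- Iterated mean value theorem for forward differences. -/
lemma exists_fwdDiff_iter_eq (n : ℕ) : ∀ (F : ℕ → ℝ → ℝ),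
    (∀ k x, 0 < x → HasDerivAt (F k) (F (k + 1) x) x) → ∀ (k : ℕ) (x : ℝ), 0 < x →
      ∃ y ∈ Set.Icc x (x + n), ((fwdDiff (1 : ℝ))^[n] (F k)) x = F (k + n) y := by
  induction n with
  | zero => intro F _ k x _; exact ⟨x, by simp, rfl⟩
  | succ n ih =>
    intro F hF k x hx
    obtain ⟨y, hy, hxy⟩ := ih (fun k => fwdDiff (1 : ℝ) (F k)) (fun k x hx => by
      have h1 := (hF k (x + 1) (by linarith)).comp_add_const x 1
      exact h1.sub (hF k x hx)) k x hx
    have hy0 : 0 < y := hx.trans_le hy.1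
    obtain ⟨z, hz, hzy⟩ := exists_hasDerivAt_eq_slope (F (k + n)) (F (k + n + 1))
      (show y < y + 1 by linarith)
      (fun u hu => (hF _ u (hy0.trans_le hu.1)).continuousAt.continuousWithinAt)
      (fun u hu => hF _ u (hy0.trans hu.1))
    refine ⟨z, ⟨hy.1.trans hz.1.le, ?_⟩, ?_⟩
    · push_cast
      linarith [hz.2, hy.2]
    · rw [Function.iterate_succ_apply, hxy, ← add_assoc, hzy, fwdDiff]
      ring

lemma exists_abs_weightCorr_le {b : ℝ} (hb : b < 4) :
    ∃ C, 0 ≤ C ∧ ∀ x : ℝ, 8 ≤ x → |weightCorr b x| ≤ C * x ^ (b - 6) := by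
  set F : ℕ → ℝ → ℝ := fun k x => (∏ i ∈ Finset.range k, (b - i)) * x ^ (b - k) with hFdef
  have hF : ∀ k x, 0 < x → HasDerivAt (F k) (F (k + 1) x) x := by
    intro k x hx
    have h1 := (Real.hasDerivAt_rpow_const (p := b - k) (Or.inl hx.ne')).const_mul
      (∏ i ∈ Finset.range k, (b - i))
    refine h1.congr_deriv ?_
    simp only [hFdef, Finset.prod_range_succ]
    push_cast
    rw [sub_sub, mul_assoc]
  set A : ℝ := |∏ i ∈ Finset.range 6, (b - i)| with hA
  refine ⟨4 * (A * (1 / 2 : ℝ) ^ (b - 6)), by positivity, fun x hx => ?_⟩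
  have hbd : ∀ y, x / 2 ≤ y → |((fwdDiff (1 : ℝ))^[6] (F 0)) y| ≤
      A * (1 / 2 : ℝ) ^ (b - 6) * x ^ (b - 6) := by
    intro y hy
    have hy0 : 0 < y := by linarith
    obtain ⟨z, hz, h⟩ := exists_fwdDiff_iter_eq 6 F hF 0 y hy0
    rw [h, mul_assoc, ← Real.mul_rpow (by norm_num) (by linarith)]
    simp only [hFdef, zero_add, abs_mul]
    rw [abs_of_nonneg (Real.rpow_nonneg (hy0.le.trans hz.1) _)]
    refine mul_le_mul_of_nonneg_left ?_ (abs_nonneg _)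
    push_cast
    exact Real.rpow_le_rpow_of_nonpos (by linarith) (by linarith [hz.1]) (by linarith)
  have hexp : weightCorr b x = -(
      ((fwdDiff (1 : ℝ))^[6] (F 0)) (x - 4) + 2 * ((fwdDiff (1 : ℝ))^[6] (F 0)) (x - 3)
      + ((fwdDiff (1 : ℝ))^[6] (F 0)) (x - 2)) := by
    simp only [fwdDiff_iter_eq_sum_shift, Finset.sum_range_succ, hFdef, weightCorr]
    have h0 : ∀ r : ℝ, -4 ≤ r → |x + r| = x + r := fun r hr => abs_of_nonneg (by linarith)
    have h1 : ∀ r : ℝ, r ≤ 4 → |x - r| = x - r := fun r hr => abs_of_nonneg (by linarith)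
    rw [abs_of_nonneg (by linarith : 0 ≤ x), h0 _ (by norm_num), h0 _ (by norm_num),
      h0 _ (by norm_num), h0 _ (by norm_num), h1 _ (by norm_num), h1 _ (by norm_num),
      h1 _ (by norm_num), h1 _ (by norm_num)]
    norm_num [Nat.choose]
    ring_nf
  have h1 := hbd (x - 4) (by linarith)
  have h2 := hbd (x - 3) (by linarith)
  have h3 := hbd (x - 2) (by linarith)
  rw [hexp, abs_neg]
  calc _ ≤ |((fwdDiff (1 : ℝ))^[6] (F 0)) (x - 4)| + 2 * |((fwdDiff (1 : ℝ))^[6] (F 0)) (x - 3)|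
      + |((fwdDiff (1 : ℝ))^[6] (F 0)) (x - 2)| := by
        refine (abs_add_le _ _).trans (add_le_add_left ((abs_add_le _ _).trans ?_) _)
        rw [abs_mul, abs_two]
    _ ≤ _ := by linarith

lemma summable_abs_weightCorr {b : ℝ} (hb : b < 4) :
    Summable fun l : ℤ => |weightCorr b (4 * l)| := by
  obtain ⟨C, hC, hbd⟩ := exists_abs_weightCorr_le hb
  have hs : Summable fun l : ℤ => C * (4 : ℝ) ^ (b - 6) * |(l : ℝ)| ^ (b - 6) := by
    have := Real.summable_abs_int_rpow (b := 6 - b) (by linarith)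
    simpa using this.mul_left (C * (4 : ℝ) ^ (b - 6))
  refine hs.of_norm_bounded_eventually ?_
  have hfin : (Set.Icc (-1 : ℤ) 1).Finite := Set.finite_Icc _ _
  filter_upwards [hfin.compl_mem_cofinite] with l hl
  have hl2 : 2 ≤ |(l : ℝ)| := by
    have : 2 ≤ |l| := by
      by_contra h
      exact hl (abs_le.1 (by omega))
    exact_mod_cast this
  have habs : |weightCorr b (4 * l)| = |weightCorr b (4 * |(l : ℝ)|)| := by
    rcases abs_choice (l : ℝ) with h | h
    · rw [h]
    · rw [h, mul_neg, weightCorr_neg]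
  rw [Real.norm_eq_abs, abs_abs, habs, mul_assoc, ← Real.mul_rpow (by norm_num) (abs_nonneg _)]
  exact hbd _ (by linarith)

lemma abs_riemannSum_sub_integral_le {g : ℝ → ℝ} (hg : ContinuousOn g (Set.Icc 0 1)) {M : ℕ}
    (hM : 0 < M) {ε : ℝ}
    (h : ∀ x ∈ Set.Icc (0 : ℝ) 1, ∀ y ∈ Set.Icc (0 : ℝ) 1, |x - y| ≤ 1 / M → |g x - g y| ≤ ε) :
    |(∑ p ∈ Finset.range M, g (p / M)) / M - ∫ x in (0 : ℝ)..1, g x| ≤ ε := by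
  have hM0 : (0 : ℝ) < M := by exact_mod_cast hM
  have hsub : ∀ p ∈ Finset.range M, Set.uIcc ((p : ℝ) / M) ((p + 1 : ℕ) / M) ⊆ Set.Icc 0 1 := by
    intro p hp
    have hp' : ((p + 1 : ℕ) : ℝ) ≤ M := by exact_mod_cast Finset.mem_range.1 hp
    rw [Set.uIcc_of_le (by gcongr; simp)]
    exact Set.Icc_subset_Icc (by positivity) ((div_le_one hM0).2 hp')
  have hint : ∀ p ∈ Finset.range M,
      IntervalIntegrable g volume ((p : ℝ) / M) ((p + 1 : ℕ) / M) := fun p hp =>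
    (hg.mono (hsub p hp)).intervalIntegrable
  have hsum := intervalIntegral.sum_integral_adjacent_intervals (μ := volume) (f := g)
    (a := fun p : ℕ => (p : ℝ) / M) (n := M) fun p hp => hint p (Finset.mem_range.2 hp)
  simp only [Nat.cast_zero, zero_div, div_self hM0.ne'] at hsum
  rw [← hsum, Finset.sum_div, ← Finset.sum_sub_distrib]
  refine (Finset.abs_sum_le_sum_abs _ _).trans ?_
  have hterm : ∀ p ∈ Finset.range M,
      |g (p / M) / M - ∫ x in ((p : ℝ) / M)..((p + 1 : ℕ) / M), g x| ≤ ε / M := by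
    intro p hp
    have hlen : ((p + 1 : ℕ) : ℝ) / M - (p : ℝ) / M = 1 / M := by push_cast; ring
    have hle : (p : ℝ) / M ≤ ((p + 1 : ℕ) : ℝ) / M := by gcongr; simp
    have h1 : g (p / M) / M - ∫ x in ((p : ℝ) / M)..((p + 1 : ℕ) / M), g x =
        ∫ x in ((p : ℝ) / M)..((p + 1 : ℕ) / M), (g (p / M) - g x) := by
      rw [intervalIntegral.integral_sub (by simp) (hint p hp), intervalIntegral.integral_const,
        hlen, smul_eq_mul]
      ring
    rw [h1]
    have h2 := intervalIntegral.norm_integral_le_of_norm_le_const (C := ε)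
      (f := fun x => g (p / M) - g x) (a := (p : ℝ) / M) (b := ((p + 1 : ℕ) : ℝ) / M) (by
        intro x hx
        have hx' : x ∈ Set.uIcc ((p : ℝ) / M) ((p + 1 : ℕ) / M) := Set.uIoc_subset_uIcc hx
        refine h _ (hsub p hp Set.left_mem_uIcc) _ (hsub p hp hx') ?_
        rw [Set.uIcc_of_le hle] at hx'
        rw [abs_sub_comm, abs_of_nonneg (by linarith [hx'.1])]
        linarith [hx'.2])
    rw [hlen, abs_of_pos (by positivity)] at h2
    simpa [div_eq_mul_inv] using h2
  refine (Finset.sum_le_sum hterm).trans (le_of_eq ?_)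
  rw [Finset.sum_const, Finset.card_range, nsmul_eq_mul]
  field_simp

lemma tendsto_riemannSum {g : ℝ → ℝ} (hg : ContinuousOn g (Set.Icc 0 1)) :
    Tendsto (fun M : ℕ => (∑ p ∈ Finset.range M, g (p / M)) / M) atTop
      (nhds (∫ x in (0 : ℝ)..1, g x)) := by
  have huc := isCompact_Icc.uniformContinuousOn_of_continuous hg
  rw [Metric.tendsto_atTop]
  intro ε hε
  obtain ⟨d, hd, h⟩ := Metric.uniformContinuousOn_iff.1 huc (ε / 2) (by positivity)
  obtain ⟨n, hn⟩ := exists_nat_one_div_lt hd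
  refine ⟨n + 1, fun M hM => ?_⟩
  have hM' : (n : ℝ) + 1 ≤ M := by exact_mod_cast hM
  have h1 : (1 : ℝ) / M < d := (one_div_le_one_div_of_le (by positivity) hM').trans_lt hn
  refine lt_of_le_of_lt ?_ (half_lt_self hε)
  exact abs_riemannSum_sub_integral_le hg (by omega) fun x hx y hy hxy =>
    (h x hx y hy (hxy.trans_lt h1)).le

lemma tendsto_riemannSum₂ {F : ℝ → ℝ → ℝ} (hF : Continuous fun z : ℝ × ℝ => F z.1 z.2) :
    Tendsto (fun M : ℕ => (∑ p ∈ Finset.range M,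
        (∑ q ∈ Finset.range M, F (p / M) (q / M)) / M) / M) atTop
      (nhds (∫ x in (0 : ℝ)..1, ∫ y in (0 : ℝ)..1, F x y)) := by
  have hG : Continuous fun x => ∫ y in (0 : ℝ)..1, F x y :=
    intervalIntegral.continuous_parametric_intervalIntegral_of_continuous' hF _ _
  have hlim := tendsto_riemannSum hG.continuousOn
  have huc := (isCompact_Icc.prod isCompact_Icc :
    IsCompact (Set.Icc (0 : ℝ) 1 ×ˢ Set.Icc (0 : ℝ) 1)).uniformContinuousOn_of_continuous
      hF.continuousOn
  refine hlim.congr_dist ?_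
  rw [Metric.tendsto_atTop]
  intro ε hε
  obtain ⟨d, hd, h⟩ := Metric.uniformContinuousOn_iff.1 huc (ε / 2) (by positivity)
  obtain ⟨n, hn⟩ := exists_nat_one_div_lt hd
  refine ⟨n + 1, fun M hM => ?_⟩
  have hM' : (n : ℝ) + 1 ≤ M := by exact_mod_cast hM
  have hM0 : (0 : ℝ) < M := lt_of_lt_of_le (by positivity) hM'
  have h1 : (1 : ℝ) / M < d := (one_div_le_one_div_of_le (by positivity) hM').trans_lt hn
  rw [Real.dist_0_eq_abs, abs_of_nonneg dist_nonneg, dist_comm, Real.dist_eq, ← sub_div,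
    ← Finset.sum_sub_distrib, abs_div, abs_of_pos hM0, div_lt_iff₀ hM0]
  refine (Finset.abs_sum_le_sum_abs _ _).trans_lt ?_
  refine (Finset.sum_le_sum (g := fun _ => ε / 2) fun p hp => ?_).trans_lt ?_
  · have hp' : (p : ℝ) ≤ M := by exact_mod_cast (Finset.mem_range.1 hp).le
    have hpm : (p : ℝ) / M ∈ Set.Icc (0 : ℝ) 1 := ⟨by positivity, (div_le_one hM0).2 hp'⟩
    refine abs_riemannSum_sub_integral_le
      (hF.comp (by fun_prop : Continuous fun y : ℝ => ((p : ℝ) / M, y))).continuousOn (by omega)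
      fun x hx y hy hxy => (h (p / M, x) ⟨hpm, hx⟩ (p / M, y) ⟨hpm, hy⟩ ?_).le
    rw [Prod.dist_eq, dist_self, max_eq_right dist_nonneg]
    exact hxy.trans_lt h1
  · rw [Finset.sum_const, Finset.card_range, nsmul_eq_mul]
    nlinarith

/-- The covariance function of the integral of a fractional Brownian motion, with `a = 2 * H`. -/
noncomputable def integratedCov (a t s : ℝ) : ℝ :=
  (s * (t ^ (a + 1) / (a + 1)) + t * (s ^ (a + 1) / (a + 1))
    + (|t - s| ^ (a + 2) - |t| ^ (a + 2) - |s| ^ (a + 2)) / ((a + 1) * (a + 2))) / 2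

lemma hasDerivAt_mul_abs_rpow {a : ℝ} (ha : 0 < a) (x : ℝ) :
    HasDerivAt (fun z : ℝ => z * |z| ^ a / (a + 1)) (|x| ^ a) x := by
  have ha1 : a + 1 ≠ 0 := by positivity
  rcases lt_trichotomy x 0 with hx | hx | hx
  · have h1 := ((hasDerivAt_neg x).rpow_const (p := a + 1) (Or.inl (by linarith))).neg.div_const
      (a + 1)
    refine (h1.congr_deriv ?_).congr_of_eventuallyEq ?_
    · rw [abs_of_neg hx, add_sub_cancel_right]; field_simp
    · filter_upwards [Iio_mem_nhds hx] with z hz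
      have hz' : 0 < -z := neg_pos.2 hz
      simp only [Pi.neg_apply]
      rw [abs_of_neg hz, Real.rpow_add_one hz'.ne']; ring
  · subst hx
    rw [abs_zero, Real.zero_rpow ha.ne', hasDerivAt_iff_tendsto_slope]
    have h1 : Tendsto (fun z : ℝ => |z| ^ a / (a + 1)) (nhdsWithin 0 {0}ᶜ) (nhds 0) := by
      have : Continuous fun z : ℝ => |z| ^ a / (a + 1) :=
        (continuous_abs.rpow_const fun _ => Or.inr ha.le).div_const _
      have h2 := this.tendsto 0
      simp only [abs_zero, Real.zero_rpow ha.ne', zero_div] at h2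
      exact h2.mono_left nhdsWithin_le_nhds
    refine h1.congr' ?_
    filter_upwards [self_mem_nhdsWithin] with z hz
    have hz' : z ≠ 0 := hz
    simp [slope_def_field]
    field_simp
  · have h1 := (Real.hasDerivAt_rpow_const (p := a + 1) (Or.inl hx.ne')).div_const (a + 1)
    refine (h1.congr_deriv ?_).congr_of_eventuallyEq ?_
    · rw [abs_of_pos hx]; simp; field_simp
    · filter_upwards [Ioi_mem_nhds hx] with z hz
      have hz' : 0 < z := hz
      rw [abs_of_pos hz', Real.rpow_add_one hz'.ne']; ring

lemma continuous_fbmCov {H : ℝ} (hH : 0 < H) :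
    Continuous fun z : ℝ × ℝ => fbmCov H z.1 z.2 := by
  have h : Continuous fun x : ℝ => x ^ (2 * H) := Real.continuous_rpow_const (by positivity)
  unfold fbmCov
  exact (((h.comp continuous_fst).add (h.comp continuous_snd)).sub
    (h.comp (continuous_fst.sub continuous_snd).abs)).div_const 2

lemma integral_integral_fbmCov {H : ℝ} (hH : 0 < H) (t s : ℝ) :
    t * s * ∫ x in (0 : ℝ)..1, ∫ y in (0 : ℝ)..1, fbmCov H (t * x) (s * y) =
      integratedCov (2 * H) t s := by
  set a := 2 * H with ha
  have ha0 : 0 < a := by positivity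
  have hc := continuous_fbmCov hH
  have hinner : ∀ u : ℝ, s * ∫ y in (0 : ℝ)..1, fbmCov H u (s * y) =
      (s * u ^ a + s ^ (a + 1) / (a + 1) + (u - s) * |u - s| ^ a / (a + 1)
        - u * |u| ^ a / (a + 1)) / 2 := by
    intro u
    rw [intervalIntegral.mul_integral_comp_mul_left (f := fun y => fbmCov H u y), mul_zero, mul_one]
    have hderiv : ∀ y : ℝ, HasDerivAt (fun y => (y * u ^ a + y ^ (a + 1) / (a + 1)
        + (u - y) * |u - y| ^ a / (a + 1)) / 2) (fbmCov H u y) y := by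
      intro y
      have h1 := (hasDerivAt_id y).mul_const (u ^ a)
      have h2 := (Real.hasDerivAt_rpow_const (x := y) (p := a + 1) (Or.inr (by linarith))).div_const
        (a + 1)
      have h3 := (hasDerivAt_mul_abs_rpow ha0 (u - y)).comp y ((hasDerivAt_id y).const_sub u)
      refine (((h1.add h2).add h3).div_const 2).congr_deriv ?_
      have : a + 1 ≠ 0 := by positivity
      simp only [fbmCov, ← ha, add_sub_cancel_right]
      field_simp
      ring
    rw [intervalIntegral.integral_eq_sub_of_hasDerivAt (fun y _ => hderiv y)
      (hc.comp (by fun_prop : Continuous fun y : ℝ => (u, y))).continuousOn.intervalIntegrable]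
    simp only [sub_zero, zero_mul, Real.zero_rpow (by positivity : a + 1 ≠ 0)]
    ring
  rw [mul_assoc, ← intervalIntegral.integral_const_mul]
  simp_rw [hinner]
  rw [intervalIntegral.mul_integral_comp_mul_left (f := fun u => (s * u ^ a + s ^ (a + 1) / (a + 1)
    + (u - s) * |u - s| ^ a / (a + 1) - u * |u| ^ a / (a + 1)) / 2), mul_zero, mul_one]
  have hderiv : ∀ u : ℝ, HasDerivAt (fun u => integratedCov a u s)
      ((s * u ^ a + s ^ (a + 1) / (a + 1)
    + (u - s) * |u - s| ^ a / (a + 1) - u * |u| ^ a / (a + 1)) / 2) u := by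
    intro u
    have h1 := ((Real.hasDerivAt_rpow_const (x := u) (p := a + 1)
      (Or.inr (by linarith))).div_const (a + 1)).const_mul s
    have h2 := (hasDerivAt_id u).mul_const (s ^ (a + 1) / (a + 1))
    have h3 := (hasDerivAt_abs_rpow (u - s) (p := a + 2) (by linarith)).comp u
      ((hasDerivAt_id u).sub_const s)
    have h4 := hasDerivAt_abs_rpow u (p := a + 2) (by linarith)
    refine (((h1.add h2).add (((h3.sub h4).sub_const (|s| ^ (a + 2))).div_const
      ((a + 1) * (a + 2)))).div_const 2).congr_deriv ?_
    have : a + 1 ≠ 0 := by positivity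
    have : a + 2 ≠ 0 := by positivity
    simp only [add_sub_cancel_right]
    field_simp
    ring
  rw [intervalIntegral.integral_eq_sub_of_hasDerivAt (fun u _ => hderiv u)]
  · have : |0 - s| = |s| := by rw [zero_sub, abs_neg]
    simp only [integratedCov, this, abs_zero, Real.zero_rpow (by positivity : a + 1 ≠ 0),
      Real.zero_rpow (by positivity : a + 2 ≠ 0)]
    ring
  · refine ContinuousOn.intervalIntegrable (Continuous.continuousOn ?_)
    have h : Continuous fun x : ℝ => x ^ a := Real.continuous_rpow_const ha0.le
    have h' : Continuous fun x : ℝ => |x| ^ a := h.comp continuous_abs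
    have h'' : Continuous fun x : ℝ => |x - s| ^ a := h'.comp (continuous_sub_right s)
    fun_prop

section FBM

variable {Ω : Type*} [MeasurableSpace Ω] {P : Measure Ω}

lemma IsFBM.map_sum {H : ℝ} {W : ℝ → Ω → ℝ} (hW : IsFBM P H W) {ι : Type*} [Fintype ι]
    (t c : ι → ℝ) (ht : ∀ i, t i ∈ Set.Icc (0 : ℝ) 1) :
    P.map (fun ω => ∑ i, c i * W (t i) ω) =
      gaussianReal 0 (∑ i, ∑ j, c i * c j * fbmCov H (t i) (t j)).toNNReal := by
  have e := (Fintype.equivFin ι).symm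
  have h := hW.2.2 (Fintype.card ι) (t ∘ e) (c ∘ e) fun i => ht _
  simp only [Function.comp_apply] at h
  rw [← Equiv.sum_comp e fun i => ∑ j, c i * c j * fbmCov H (t i) (t j)]
  simp_rw [← Equiv.sum_comp e fun j => c _ * c j * fbmCov H (t _) (t j)]
  rw [← h]
  congr 1
  ext ω
  exact (Equiv.sum_comp e fun i => c i * W (t i) ω).symm

lemma memLp_two_of_map_eq_gaussianReal {X : Ω → ℝ} (hX : AEMeasurable X P) {v : NNReal}
    (h : P.map X = gaussianReal 0 v) : MemLp X 2 P := by
  have := memLp_id_gaussianReal' (μ := 0) (v := v) 2 (by simp)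
  rw [← h] at this
  exact this.comp_of_map hX

lemma integral_sq_of_map_eq_gaussianReal {X : Ω → ℝ} (hX : AEMeasurable X P) {v : NNReal}
    (h : P.map X = gaussianReal 0 v) : ∫ ω, X ω ^ 2 ∂P = v := by
  have h1 : ∫ ω, X ω ^ 2 ∂P = ∫ x, x ^ 2 ∂(gaussianReal 0 v) := by
    rw [← h, integral_map hX (by fun_prop)]
  rw [h1, ← variance_fun_id_gaussianReal (μ := 0) (v := v),
    variance_eq_integral measurable_id'.aemeasurable, integral_id_gaussianReal]
  simp

/-- The covariance kernel of a fractional Brownian motion is positive semidefinite. -/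
lemma IsFBM.sum_fbmCov_nonneg {H : ℝ} (hH : 0 < H) {W : ℝ → Ω → ℝ} (hW : IsFBM P H W)
    {ι : Type*} [Fintype ι] (t c : ι → ℝ) (ht : ∀ i, t i ∈ Set.Icc (0 : ℝ) 1) :
    0 ≤ ∑ i, ∑ j, c i * c j * fbmCov H (t i) (t j) := by
  have hLp : ∀ s ∈ Set.Icc (0 : ℝ) 1, MemLp (W s) 2 P ∧ ∫ ω, W s ω ^ 2 ∂P = fbmCov H s s := by
    intro s hs
    have h := hW.map_sum (fun _ : Unit => s) (fun _ => 1) fun _ => hs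
    simp only [Finset.univ_unique, Finset.sum_singleton, one_mul] at h
    refine ⟨memLp_two_of_map_eq_gaussianReal (hW.1 s).aemeasurable h, ?_⟩
    rw [integral_sq_of_map_eq_gaussianReal (hW.1 s).aemeasurable h, Real.coe_toNNReal]
    have := Real.rpow_nonneg hs.1 (2 * H)
    simp only [fbmCov, sub_self, abs_zero, Real.zero_rpow (by positivity : 2 * H ≠ 0)]
    linarith
  have hcov : ∀ s ∈ Set.Icc (0 : ℝ) 1, ∀ u ∈ Set.Icc (0 : ℝ) 1,
      ∫ ω, W s ω * W u ω ∂P = fbmCov H s u := by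
    intro s hs u hu
    have h := hW.map_sum ![s, u] ![1, -1] (by intro i; fin_cases i; exacts [hs, hu])
    simp only [Fin.sum_univ_two, Matrix.cons_val_zero, Matrix.cons_val_one] at h
    have h2 := integral_sq_of_map_eq_gaussianReal
      (by have := hW.1 s; have := hW.1 u; fun_prop) h
    have hv : 1 * 1 * fbmCov H s s + 1 * -1 * fbmCov H s u +
        (-1 * 1 * fbmCov H u s + -1 * -1 * fbmCov H u u) = |s - u| ^ (2 * H) := by
      simp only [fbmCov, sub_self, abs_zero, Real.zero_rpow (by positivity : 2 * H ≠ 0),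
        abs_sub_comm u s]
      ring
    rw [hv, Real.coe_toNNReal _ (Real.rpow_nonneg (abs_nonneg _) _)] at h2
    have h3 : ∀ ω, W s ω * W u ω = (W s ω ^ 2 + W u ω ^ 2 - (1 * W s ω + -1 * W u ω) ^ 2) / 2 :=
      fun ω => by ring
    simp_rw [h3]
    have i1 := (hLp s hs).1.integrable_sq
    have i2 := (hLp u hu).1.integrable_sq
    have i3 : Integrable (fun ω => (1 * W s ω + -1 * W u ω) ^ 2) P :=
      (((hLp s hs).1.const_mul 1).add ((hLp u hu).1.const_mul (-1))).integrable_sq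
    have i12 : Integrable (fun ω => W s ω ^ 2 + W u ω ^ 2) P := i1.add i2
    rw [integral_div, integral_sub i12 i3, integral_add i1 i2, h2, (hLp s hs).2,
      (hLp u hu).2]
    simp only [fbmCov, sub_self, abs_zero, Real.zero_rpow (by positivity : 2 * H ≠ 0)]
    ring
  have hsq : ∫ ω, (∑ i, c i * W (t i) ω) ^ 2 ∂P =
      ∑ i, ∑ j, c i * c j * fbmCov H (t i) (t j) := by
    have hi : ∀ i j, Integrable (fun ω => c i * c j * (W (t i) ω * W (t j) ω)) P := fun i j =>
      ((hLp _ (ht i)).1.integrable_mul (hLp _ (ht j)).1).const_mul _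
    have h1 : ∀ ω, (∑ i, c i * W (t i) ω) ^ 2 =
        ∑ i, ∑ j, c i * c j * (W (t i) ω * W (t j) ω) := fun ω => by
      rw [sq, Finset.sum_mul_sum]
      exact Finset.sum_congr rfl fun i _ => Finset.sum_congr rfl fun j _ => by ring
    simp_rw [h1]
    rw [integral_finsetSum _ fun i _ => integrable_finsetSum _ fun j _ => hi i j]
    refine Finset.sum_congr rfl fun i _ => ?_
    rw [integral_finsetSum _ fun j _ => hi i j]
    refine Finset.sum_congr rfl fun j _ => ?_
    rw [integral_const_mul, hcov _ (ht i) _ (ht j)]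
  rw [← hsq]
  exact integral_nonneg fun ω => sq_nonneg _

/-- Almost sure limits of centered Gaussian variables with converging variances. -/
lemma map_eq_gaussianReal_of_tendsto [IsProbabilityMeasure P] {X : ℕ → Ω → ℝ} {Y : Ω → ℝ}
    (hX : ∀ n, AEMeasurable (X n) P) {v : ℕ → ℝ} {w : ℝ}
    (hlaw : ∀ n, P.map (X n) = gaussianReal 0 (v n).toNNReal)
    (hY : ∀ᵐ ω ∂P, Tendsto (fun n => X n ω) atTop (nhds (Y ω)))
    (hv : Tendsto v atTop (nhds w)) : P.map Y = gaussianReal 0 w.toNNReal := by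
  have hYm : AEMeasurable Y P := aemeasurable_of_tendsto_metrizable_ae atTop hX hY
  have : IsProbabilityMeasure (P.map Y) := Measure.isProbabilityMeasure_map hYm
  refine Measure.ext_of_charFun (funext fun s => ?_)
  have h1 : Tendsto (fun n => charFun (P.map (X n)) s) atTop (nhds (charFun (P.map Y) s)) := by
    simp_rw [charFun_apply_real]
    rw [integral_map hYm (by fun_prop)]
    have hm : ∀ n, ∫ x, Complex.exp (s * x * Complex.I) ∂(P.map (X n)) =
        ∫ ω, Complex.exp (s * X n ω * Complex.I) ∂P := fun n =>
      integral_map (hX n) (by fun_prop)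
    simp_rw [hm]
    refine tendsto_integral_of_dominated_convergence (fun _ => 1) (fun n => ?_)
      (integrable_const _) (fun n => ae_of_all _ fun ω => ?_) ?_
    · have := hX n
      exact AEMeasurable.aestronglyMeasurable (by fun_prop)
    · rw [← Complex.ofReal_mul, Complex.norm_exp_ofReal_mul_I]
    · filter_upwards [hY] with ω hω
      have hc : Continuous fun x : ℝ => Complex.exp (s * x * Complex.I) := by fun_prop
      exact (hc.tendsto _).comp hω
  have h2 : Tendsto (fun n => charFun (P.map (X n)) s) atTop
      (nhds (charFun (gaussianReal 0 w.toNNReal) s)) := by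
    simp_rw [hlaw, charFun_gaussianReal]
    have hc : Continuous fun x : ℝ =>
        Complex.exp (s * (0 : ℝ) * Complex.I - (x.toNNReal : ℝ) * s ^ 2 / 2) := by
      have := continuous_real_toNNReal
      fun_prop
    exact (hc.tendsto w).comp hv
  exact tendsto_nhds_unique h1 h2

/-- Riemann sum approximating `∫₀ᵗ W_s ds`. -/
noncomputable def riemannApprox (W : ℝ → Ω → ℝ) (M : ℕ) (t : ℝ) (ω : Ω) : ℝ :=
  t * ((∑ p ∈ Finset.range M, W (t * (p / M)) ω) / M)

lemma IsFBM.ae_tendsto_riemannApprox {H : ℝ} {W : ℝ → Ω → ℝ} (hW : IsFBM P H W) :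
    ∀ᵐ ω ∂P, ∀ t ∈ Set.Icc (0 : ℝ) 1,
      Tendsto (fun M => riemannApprox W M t ω) atTop (nhds (∫ s in (0 : ℝ)..t, W s ω)) := by
  filter_upwards [hW.2.1] with ω hω t ht
  have hc : ContinuousOn (fun x => W (t * x) ω) (Set.Icc 0 1) :=
    hω.comp (by fun_prop) fun x hx => ⟨mul_nonneg ht.1 hx.1, mul_le_one₀ ht.2 hx.1 hx.2⟩
  have h := (tendsto_riemannSum hc).const_mul t
  rwa [intervalIntegral.mul_integral_comp_mul_left (f := fun s => W s ω), mul_zero, mul_one] at h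

lemma IsFBM.aemeasurable_integral {H : ℝ} {W : ℝ → Ω → ℝ} (hW : IsFBM P H W) {t : ℝ}
    (ht : t ∈ Set.Icc (0 : ℝ) 1) : AEMeasurable (fun ω => ∫ s in (0 : ℝ)..t, W s ω) P := by
  refine aemeasurable_of_tendsto_metrizable_ae atTop (f := fun M => riemannApprox W M t)
    (fun M => ?_) ?_
  · have := hW.1
    unfold riemannApprox
    fun_prop
  · filter_upwards [hW.ae_tendsto_riemannApprox] with ω hω using hω t ht

/-- The integral of a fractional Brownian motion is a centered Gaussian process with covariance
`integratedCov (2 * H)`. -/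
lemma IsFBM.map_sum_integral [IsProbabilityMeasure P] {H : ℝ} (hH : 0 < H) {W : ℝ → Ω → ℝ}
    (hW : IsFBM P H W) {ι : Type*} [Fintype ι] (t c : ι → ℝ)
    (ht : ∀ i, t i ∈ Set.Icc (0 : ℝ) 1) :
    P.map (fun ω => ∑ i, c i * ∫ s in (0 : ℝ)..(t i), W s ω) =
        gaussianReal 0 (∑ i, ∑ j, c i * c j * integratedCov (2 * H) (t i) (t j)).toNNReal ∧
      0 ≤ ∑ i, ∑ j, c i * c j * integratedCov (2 * H) (t i) (t j) := by
  set v : ℕ → ℝ := fun M => ∑ i, ∑ j, c i * c j * (t i * t j *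
    ((∑ p ∈ Finset.range M, (∑ q ∈ Finset.range M,
      fbmCov H (t i * (p / M)) (t j * (q / M))) / M) / M)) with hvdef
  have hv : Tendsto v atTop (nhds (∑ i, ∑ j, c i * c j * integratedCov (2 * H) (t i) (t j))) := by
    refine tendsto_finsetSum _ fun i _ => tendsto_finsetSum _ fun j _ => ?_
    rw [← integral_integral_fbmCov hH]
    refine Tendsto.const_mul _ (Tendsto.const_mul _ ?_)
    exact tendsto_riemannSum₂ (F := fun x y => fbmCov H (t i * x) (t j * y))
      ((continuous_fbmCov hH).comp
        (by fun_prop : Continuous fun z : ℝ × ℝ => (t i * z.1, t j * z.2)))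
  have hmem : ∀ (M : ℕ) (z : ι × Fin M), t z.1 * ((z.2 : ℕ) / M : ℝ) ∈ Set.Icc (0 : ℝ) 1 := by
    intro M z
    have hM : (0 : ℝ) < M := by exact_mod_cast z.2.pos
    have hz : ((z.2 : ℕ) : ℝ) / M ≤ 1 := (div_le_one hM).2 (by exact_mod_cast z.2.is_lt.le)
    exact ⟨mul_nonneg (ht _).1 (by positivity), mul_le_one₀ (ht _).2 (by positivity) hz⟩
  have hsum : ∀ M ω, ∑ i, c i * riemannApprox W M (t i) ω =
      ∑ z : ι × Fin M, c z.1 * t z.1 / M * W (t z.1 * ((z.2 : ℕ) / M)) ω := by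
    intro M ω
    rw [Fintype.sum_prod_type]
    refine Finset.sum_congr rfl fun i _ => ?_
    simp only [riemannApprox]
    rw [Finset.sum_range, Finset.sum_div, Finset.mul_sum, Finset.mul_sum]
    exact Finset.sum_congr rfl fun p _ => by ring
  have hvM : ∀ M, ∑ z : ι × Fin M, ∑ z' : ι × Fin M, (c z.1 * t z.1 / M) * (c z'.1 * t z'.1 / M) *
      fbmCov H (t z.1 * ((z.2 : ℕ) / M)) (t z'.1 * ((z'.2 : ℕ) / M)) = v M := by
    intro M
    simp only [Fintype.sum_prod_type, hvdef]
    refine Finset.sum_congr rfl fun i _ => ?_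
    rw [Finset.sum_comm]
    refine Finset.sum_congr rfl fun j _ => ?_
    rw [Finset.sum_range, Finset.sum_div, Finset.mul_sum, Finset.mul_sum]
    refine Finset.sum_congr rfl fun p _ => ?_
    rw [Finset.sum_range, Finset.sum_div, Finset.sum_div, Finset.mul_sum, Finset.mul_sum]
    exact Finset.sum_congr rfl fun q _ => by ring
  refine ⟨map_eq_gaussianReal_of_tendsto (X := fun M ω => ∑ i, c i * riemannApprox W M (t i) ω)
    (fun M => ?_) (fun M => ?_) ?_ hv, ge_of_tendsto' hv fun M => ?_⟩
  · have := hW.1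
    simp_rw [hsum]
    fun_prop
  · simp_rw [hsum]
    rw [hW.map_sum (fun z : ι × Fin M => t z.1 * ((z.2 : ℕ) / M : ℝ))
      (fun z => c z.1 * t z.1 / M) (hmem M), hvM]
  · filter_upwards [hW.ae_tendsto_riemannApprox] with ω hω
    exact tendsto_finsetSum _ fun i _ => (hω _ (ht i)).const_mul _
  · rw [← hvM]
    exact hW.sum_fbmCov_nonneg hH (fun z : ι × Fin M => t z.1 * ((z.2 : ℕ) / M : ℝ))
      (fun z => c z.1 * t z.1 / M) (hmem M)

/-- Second differences with weights `(1, -2, 0, 2, -1)` reduce `integratedCov` to its stationary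
part. -/
lemma sum_integratedCov_eq {h : ℝ} (hh : 0 ≤ h) (a j k : ℝ) :
    ∑ r : Fin 4, ∑ q : Fin 4, (![1, -2, 2, -1] : Fin 4 → ℝ) r * (![1, -2, 2, -1] : Fin 4 → ℝ) q *
        integratedCov a ((4 * j + (![0, 1, 3, 4] : Fin 4 → ℝ) r) * h)
          ((4 * k + (![0, 1, 3, 4] : Fin 4 → ℝ) q) * h) =
      h ^ (a + 2) / (2 * ((a + 1) * (a + 2))) * weightCorr (a + 2) (4 * (j - k)) := by
  have key : ∀ r q : ℝ, |(4 * j + r) * h - (4 * k + q) * h| ^ (a + 2) =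
      h ^ (a + 2) * |4 * (j - k) + (r - q)| ^ (a + 2) := by
    intro r q
    rw [← Real.mul_rpow hh (abs_nonneg _)]
    congr 1
    conv_rhs => rw [← abs_of_nonneg hh, ← abs_mul]
    ring_nf
  rw [mul_comm 2, ← div_div]
  simp only [integratedCov, key, weightCorr, Fin.sum_univ_four, Matrix.cons_val]
  simp only [div_eq_mul_inv _ ((a + 1) * (a + 2))]
  generalize ((a + 1) * (a + 2))⁻¹ = I
  norm_num
  simp only [← sub_eq_add_neg]
  ring

lemma IsFBM.map_sum_vartheta [IsProbabilityMeasure P] {H : ℝ} (hH : 0 < H) {W : ℝ → Ω → ℝ}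
    (hW : IsFBM P H W) {ι : Type*} [Fintype ι] (m : ℕ) (k : ι → ℕ) (hk : ∀ i, k i < 2 ^ m)
    (c : ι → ℝ) :
    P.map (fun ω => ∑ i, c i * vartheta (fun t => ∫ s in (0 : ℝ)..t, W s ω) m (k i)) =
        gaussianReal 0 (∑ i, ∑ j, c i * c j * (((2 : ℝ) ^ ((3 * (m : ℝ)) / 2 + 3)) ^ 2 *
          ((1 / 2 ^ (m + 2) : ℝ) ^ (2 * H + 2) / (2 * ((2 * H + 1) * (2 * H + 2))) *
            weightCorr (2 * H + 2) (4 * (k i - k j))))).toNNReal ∧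
      0 ≤ ∑ i, ∑ j, c i * c j * (((2 : ℝ) ^ ((3 * (m : ℝ)) / 2 + 3)) ^ 2 *
          ((1 / 2 ^ (m + 2) : ℝ) ^ (2 * H + 2) / (2 * ((2 * H + 1) * (2 * H + 2))) *
            weightCorr (2 * H + 2) (4 * (k i - k j)))) := by
  set h : ℝ := 1 / 2 ^ (m + 2) with hh
  set C : ℝ := (2 : ℝ) ^ ((3 * (m : ℝ)) / 2 + 3) with hC
  have hmem : ∀ z : ι × Fin 4, (4 * (k z.1 : ℝ) + (![0, 1, 3, 4] : Fin 4 → ℝ) z.2) * h ∈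
      Set.Icc (0 : ℝ) 1 := by
    rintro ⟨i, r⟩
    have hr : 0 ≤ (![0, 1, 3, 4] : Fin 4 → ℝ) r ∧ (![0, 1, 3, 4] : Fin 4 → ℝ) r ≤ 4 := by
      fin_cases r <;> norm_num
    have hi : (k i : ℝ) + 1 ≤ 2 ^ m := by exact_mod_cast hk i
    refine ⟨mul_nonneg (add_nonneg (by positivity) hr.1) (by positivity), ?_⟩
    rw [hh, mul_one_div, div_le_one (by positivity), pow_add]
    dsimp only
    linarith [hr.2]
  have hsum : ∀ ω, ∑ i, c i * vartheta (fun t => ∫ s in (0 : ℝ)..t, W s ω) m (k i) =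
      ∑ z : ι × Fin 4, c z.1 * C * (![1, -2, 2, -1] : Fin 4 → ℝ) z.2 *
        ∫ s in (0 : ℝ)..((4 * (k z.1 : ℝ) + (![0, 1, 3, 4] : Fin 4 → ℝ) z.2) * h), W s ω := by
    intro ω
    rw [Fintype.sum_prod_type]
    refine Finset.sum_congr rfl fun i _ => ?_
    simp only [vartheta, Fin.sum_univ_four, Matrix.cons_val, hh, mul_one_div, add_zero, ← hC]
    ring
  have hcov : ∑ z : ι × Fin 4, ∑ z' : ι × Fin 4, (c z.1 * C * (![1, -2, 2, -1] : Fin 4 → ℝ) z.2) *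
      (c z'.1 * C * (![1, -2, 2, -1] : Fin 4 → ℝ) z'.2) * integratedCov (2 * H)
        ((4 * (k z.1 : ℝ) + (![0, 1, 3, 4] : Fin 4 → ℝ) z.2) * h)
        ((4 * (k z'.1 : ℝ) + (![0, 1, 3, 4] : Fin 4 → ℝ) z'.2) * h) =
      ∑ i, ∑ j, c i * c j * (C ^ 2 * (h ^ (2 * H + 2) / (2 * ((2 * H + 1) * (2 * H + 2))) *
        weightCorr (2 * H + 2) (4 * (k i - k j)))) := by
    simp only [Fintype.sum_prod_type]
    refine Finset.sum_congr rfl fun i _ => ?_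
    rw [Finset.sum_comm]
    refine Finset.sum_congr rfl fun j _ => ?_
    rw [← sum_integratedCov_eq (by positivity)]
    simp_rw [Finset.mul_sum]
    exact Finset.sum_congr rfl fun r _ => Finset.sum_congr rfl fun q _ => by ring
  have := hW.map_sum_integral hH _ (fun z : ι × Fin 4 => c z.1 * C *
    (![1, -2, 2, -1] : Fin 4 → ℝ) z.2) hmem
  rw [hcov] at this
  simp_rw [hsum]
  exact this

lemma IsFBM.aemeasurable_vartheta {H : ℝ} {W : ℝ → Ω → ℝ} (hW : IsFBM P H W) {m k : ℕ}
    (hk : k < 2 ^ m) :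
    AEMeasurable (fun ω => vartheta (fun t => ∫ s in (0 : ℝ)..t, W s ω) m k) P := by
  have hm : ∀ r ∈ Set.Icc (0 : ℝ) 4,
      AEMeasurable (fun ω => ∫ s in (0 : ℝ)..((4 * k + r) / 2 ^ (m + 2)), W s ω) P := by
    intro r hr
    refine hW.aemeasurable_integral
      ⟨div_nonneg (add_nonneg (by positivity) hr.1) (by positivity), ?_⟩
    have hi : (k : ℝ) + 1 ≤ 2 ^ m := by exact_mod_cast hk
    rw [div_le_one (by positivity), pow_add]
    linarith [hr.2]
  have h0 := hm 0 (by norm_num)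
  have h1 := hm 1 (by norm_num)
  have h3 := hm 3 (by norm_num)
  have h4 := hm 4 (by norm_num)
  rw [add_zero] at h0
  unfold vartheta
  fun_prop

lemma IsFBM.integral_vartheta_zero_sq [IsProbabilityMeasure P] {H : ℝ} (hH : 0 < H)
    {W : ℝ → Ω → ℝ} (hW : IsFBM P H W) :
    ∫ ω, vartheta (fun t => ∫ s in (0 : ℝ)..t, W s ω) 0 0 ^ 2 ∂P =
      64 * ((1 / 4 : ℝ) ^ (2 * H + 2) / (2 * ((2 * H + 1) * (2 * H + 2)))) *
        weightCorr (2 * H + 2) 0 := by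
  obtain ⟨h, h0⟩ := hW.map_sum_vartheta hH 0 (fun _ : Unit => 0) (by simp) fun _ => 1
  simp only [Finset.univ_unique, Finset.sum_singleton, one_mul, sub_self, mul_zero] at h h0
  rw [integral_sq_of_map_eq_gaussianReal (hW.aemeasurable_vartheta (by simp)) h,
    Real.coe_toNNReal _ h0]
  norm_num
  ring

/-- Consecutive rescaled coefficients have a summable stationary correlation, so that the norm of
a block concentrates. -/
lemma IsFBM.measureReal_blockNorm_le [IsProbabilityMeasure P] {H : ℝ} (hH : H ∈ Set.Ioo (0 : ℝ) 1)
    {W : ℝ → Ω → ℝ} (hW : IsFBM P H W) {tauH : ℝ}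
    (htau : tauH = ∫ ω, vartheta (fun t => ∫ s in (0 : ℝ)..t, W s ω) 0 0 ^ 2 ∂P)
    {n i : ℕ} (hi : i < 2 ^ n) {d : ℝ} (hd : 0 ≤ d) :
    P.real {ω | d ≤ |(2 : ℝ) ^ ((n : ℝ) * (2 * H - 3 / 2)) *
        Real.sqrt (blockNormSq (fun t => ∫ s in (0 : ℝ)..t, W s ω) n i) / Real.sqrt tauH - 1|} ≤
      2 * Real.exp (-(2 ^ n * d ^ 2 /
        (8 * ((∑' l : ℤ, |weightCorr (2 * H + 2) (4 * l)|) / weightCorr (2 * H + 2) 0)))) := by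
  have hb : 2 * H + 2 ∈ Set.Ioo (2 : ℝ) 4 := ⟨by linarith [hH.1], by linarith [hH.2]⟩
  have hH0 := hH.1
  have hw0 := weightCorr_zero_pos hb
  have hsumm := summable_abs_weightCorr hb.2
  rw [hW.integral_vartheta_zero_sq hH.1] at htau
  have htau0 : 0 < tauH := by rw [htau]; positivity
  set w0 := weightCorr (2 * H + 2) 0 with hw0def
  set L := (∑' l : ℤ, |weightCorr (2 * H + 2) (4 * l)|) / w0 with hL
  have hLpos : 0 < L := by
    refine div_pos (lt_of_lt_of_le hw0 ?_) hw0
    refine le_trans ?_ (hsumm.le_tsum 0 fun _ _ => abs_nonneg _)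
    simpa using le_abs_self _
  set u : ℝ := (2 : ℝ) ^ ((n : ℝ) * (2 * H - 1)) / Real.sqrt tauH with hu
  have hu2 : u ^ 2 * (((2 : ℝ) ^ ((3 * ((2 * n : ℕ) : ℝ)) / 2 + 3)) ^ 2 *
      ((1 / 2 ^ (2 * n + 2) : ℝ) ^ (2 * H + 2) / (2 * ((2 * H + 1) * (2 * H + 2))))) = 1 / w0 := by
    have e1 : (1 / 2 ^ (2 * n + 2) : ℝ) ^ (2 * H + 2) =
        (2 : ℝ) ^ (-(2 * (n : ℝ) + 2) * (2 * H + 2)) := by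
      rw [Real.rpow_mul (by norm_num), Real.rpow_neg (by norm_num), one_div]
      norm_cast
    have e2 : (1 / 4 : ℝ) ^ (2 * H + 2) = (2 : ℝ) ^ (-2 * (2 * H + 2)) := by
      rw [Real.rpow_mul (by norm_num), Real.rpow_neg (by norm_num)]
      norm_num
    have e3 : ((2 : ℝ) ^ ((n : ℝ) * (2 * H - 1))) ^ 2 *
        ((2 : ℝ) ^ ((3 * ((2 * n : ℕ) : ℝ)) / 2 + 3)) ^ 2 *
        (2 : ℝ) ^ (-(2 * (n : ℝ) + 2) * (2 * H + 2)) = 64 * (2 : ℝ) ^ (-2 * (2 * H + 2)) := by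
      rw [show (64 : ℝ) = (2 : ℝ) ^ (6 : ℝ) by norm_num]
      simp only [← Real.rpow_natCast, ← Real.rpow_mul (by norm_num : (0 : ℝ) ≤ 2),
        ← Real.rpow_add (by norm_num : (0 : ℝ) < 2)]
      push_cast
      ring_nf
    have hp : (0 : ℝ) < (2 : ℝ) ^ (-2 * (2 * H + 2)) := by positivity
    rw [e2] at htau
    rw [hu, div_pow, Real.sq_sqrt htau0.le, e1, htau]
    calc _ = ((2 : ℝ) ^ ((n : ℝ) * (2 * H - 1))) ^ 2 *
        ((2 : ℝ) ^ ((3 * ((2 * n : ℕ) : ℝ)) / 2 + 3)) ^ 2 *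
        (2 : ℝ) ^ (-(2 * (n : ℝ) + 2) * (2 * H + 2)) / (2 * ((2 * H + 1) * (2 * H + 2))) /
        (64 * ((2 : ℝ) ^ (-2 * (2 * H + 2)) / (2 * ((2 * H + 1) * (2 * H + 2)))) * w0) := by ring
      _ = _ := by
        rw [e3]
        field_simp
  have hk : ∀ j : Fin (2 ^ n), 2 ^ n * i + j < 2 ^ (2 * n) := by
    intro j
    calc 2 ^ n * i + j < 2 ^ n * i + 2 ^ n := by have := j.2; omega
      _ = 2 ^ n * (i + 1) := by ring
      _ ≤ 2 ^ n * 2 ^ n := Nat.mul_le_mul_left _ hi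
      _ = 2 ^ (2 * n) := by ring
  set Z : Fin (2 ^ n) → Ω → ℝ := fun j ω =>
    u * vartheta (fun t => ∫ s in (0 : ℝ)..t, W s ω) (2 * n) (2 ^ n * i + j) with hZdef
  set S : Matrix (Fin (2 ^ n)) (Fin (2 ^ n)) ℝ :=
    Matrix.of fun j k => weightCorr (2 * H + 2) (4 * ((j : ℕ) - (k : ℕ) : ℝ)) / w0 with hSdef
  have hquad : ∀ c : Fin (2 ^ n) → ℝ, c ⬝ᵥ S.mulVec c = ∑ j, ∑ k, (c j * u) * (c k * u) *
      (((2 : ℝ) ^ ((3 * ((2 * n : ℕ) : ℝ)) / 2 + 3)) ^ 2 *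
        ((1 / 2 ^ (2 * n + 2) : ℝ) ^ (2 * H + 2) / (2 * ((2 * H + 1) * (2 * H + 2))) *
          weightCorr (2 * H + 2)
            (4 * (((2 ^ n * i + j : ℕ) : ℝ) - ((2 ^ n * i + k : ℕ) : ℝ))))) := by
    intro c
    simp only [dotProduct, Matrix.mulVec, hSdef, Matrix.of_apply, Finset.mul_sum]
    refine Finset.sum_congr rfl fun j _ => Finset.sum_congr rfl fun k _ => ?_
    push_cast at hu2 ⊢
    rw [add_sub_add_left_eq_sub, div_eq_mul_one_div, ← hu2]
    ring
  have hlaw := fun c : Fin (2 ^ n) → ℝ =>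
    hW.map_sum_vartheta hH.1 (2 * n) (fun j : Fin (2 ^ n) => 2 ^ n * i + j) hk fun j => c j * u
  have hmain := measure_norm_gaussian_sub_one_ge_le (P := P) (Z := Z)
    (fun j => (hW.aemeasurable_vartheta (hk j)).const_mul u) (S := S)
    (Matrix.IsSymm.ext fun j k => by
      rw [hSdef, Matrix.of_apply, Matrix.of_apply, ← weightCorr_neg]; ring_nf)
    (fun c => by rw [hquad]; exact (hlaw c).2)
    (fun c => by
      rw [hquad, ← (hlaw c).1]
      congr 1
      ext ω
      exact Finset.sum_congr rfl fun j _ => by simp only [hZdef]; ring)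
    hLpos (fun j => by simp [hSdef, ← hw0def, hw0.ne'])
    (fun j => by
      simp only [hSdef, Matrix.of_apply, abs_div, abs_of_pos hw0, hL]
      rw [← Finset.sum_div]
      gcongr
      have hinj : Function.Injective fun k : Fin (2 ^ n) => ((j : ℕ) : ℤ) - ((k : ℕ) : ℤ) := by
        intro k k' h
        simp only at h
        ext
        omega
      calc ∑ k : Fin (2 ^ n), |weightCorr (2 * H + 2) (4 * ((j : ℕ) - (k : ℕ) : ℝ))|
          = ∑' k : Fin (2 ^ n), ((fun l : ℤ => |weightCorr (2 * H + 2) (4 * l)|) ∘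
            fun k : Fin (2 ^ n) => ((j : ℕ) : ℤ) - ((k : ℕ) : ℤ)) k := by
              rw [tsum_fintype]; simp
        _ ≤ _ := tsum_comp_le_tsum_of_inj hsumm (fun _ => abs_nonneg _) hinj)
    hd
  have hnorm : ∀ ω, (2 : ℝ) ^ ((n : ℝ) * (2 * H - 3 / 2)) *
      Real.sqrt (blockNormSq (fun t => ∫ s in (0 : ℝ)..t, W s ω) n i) / Real.sqrt tauH =
      Real.sqrt ((∑ j, Z j ω ^ 2) / Fintype.card (Fin (2 ^ n))) := by
    intro ω
    have h1 : (∑ j, Z j ω ^ 2) / Fintype.card (Fin (2 ^ n)) = (u ^ 2 / 2 ^ n) *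
        blockNormSq (fun t => ∫ s in (0 : ℝ)..t, W s ω) n i := by
      simp only [hZdef, mul_pow, ← Finset.mul_sum, blockNormSq, Finset.sum_range, Fintype.card_fin]
      push_cast
      ring
    have h2 : u ^ 2 / 2 ^ n = ((2 : ℝ) ^ ((n : ℝ) * (2 * H - 3 / 2)) / Real.sqrt tauH) ^ 2 := by
      rw [hu, div_pow, div_pow, div_right_comm, ← Real.rpow_natCast 2 n]
      simp only [← Real.rpow_natCast, ← Real.rpow_mul (by norm_num : (0 : ℝ) ≤ 2),
        ← Real.rpow_sub (by norm_num : (0 : ℝ) < 2)]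
      push_cast
      ring_nf
    rw [h1, h2, Real.sqrt_mul (by positivity), Real.sqrt_sq (by positivity)]
    ring
  simp_rw [hnorm]
  simpa using hmain

end FBM

/-- Concentration bound: there are `c_H, φ > 0` with
`P( sup_i |2^{n(2H-3/2)} ‖ϑ̄^Y_{2n,i}‖/√τ_H − 1| ≥ δ_n ) ≤ φ/n²` for every `n ≥ 1`,
where `Y_t = ∫₀ᵗ W^H_s ds`. -/
theorem stmt3 {Ω : Type*} [MeasurableSpace Ω] (P : Measure Ω) [IsProbabilityMeasure P]
    (H : ℝ) (hH : H ∈ Set.Ioo (0 : ℝ) 1)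
    (W : ℝ → Ω → ℝ) (hW : IsFBM P H W)
    (tauH : ℝ)
    (htau : tauH = ∫ ω, (vartheta (fun t => ∫ s in (0 : ℝ)..t, W s ω) 0 0) ^ 2 ∂P) :
    ∃ cH φ : ℝ, 0 < cH ∧ 0 < φ ∧ ∀ n : ℕ, 1 ≤ n →
      P {ω | deltaSeq cH n ≤
          ⨆ i : Fin (2 ^ n),
            |(2 : ℝ) ^ ((n : ℝ) * (2 * H - 3 / 2)) *
                Real.sqrt (blockNormSq (fun t => ∫ s in (0 : ℝ)..t, W s ω) n i) /
              Real.sqrt tauH - 1|} ≤ ENNReal.ofReal (φ / (n : ℝ) ^ 2) := by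
  have hb : 2 * H + 2 ∈ Set.Ioo (2 : ℝ) 4 := ⟨by linarith [hH.1], by linarith [hH.2]⟩
  have hw0 := weightCorr_zero_pos hb
  have hLpos : 0 < 8 * ((∑' l : ℤ, |weightCorr (2 * H + 2) (4 * l)|) /
      weightCorr (2 * H + 2) 0) := by
    refine mul_pos (by norm_num) (div_pos (lt_of_lt_of_le hw0 ?_) hw0)
    refine le_trans ?_ ((summable_abs_weightCorr hb.2).le_tsum 0 fun _ _ => abs_nonneg _)
    simpa using le_abs_self _
  set L := 8 * ((∑' l : ℤ, |weightCorr (2 * H + 2) (4 * l)|) / weightCorr (2 * H + 2) 0) with hL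
  refine ⟨Real.sqrt L, 2, by positivity, by norm_num, fun n hn => ?_⟩
  have hn0 : (0 : ℝ) < n := by exact_mod_cast hn
  have hlogn : 0 ≤ Real.log n := Real.log_nonneg (by exact_mod_cast hn)
  have hlog2 : 0 < Real.log 2 := Real.log_pos (by norm_num)
  have hδ : 0 ≤ deltaSeq (Real.sqrt L) n := by unfold deltaSeq; positivity
  have hδ2 : 2 ^ n * deltaSeq (Real.sqrt L) n ^ 2 / L = n * Real.log 2 + 2 * Real.log n := by
    rw [deltaSeq, mul_pow, mul_pow, Real.sq_sqrt hLpos.le, Real.sq_sqrt (by positivity),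
      ← Real.rpow_natCast _ 2, ← Real.rpow_mul (by norm_num)]
    push_cast
    rw [div_mul_cancel₀ _ (by norm_num), Real.rpow_neg (by norm_num), Real.rpow_natCast]
    field_simp
  have hexp : Real.exp (-(2 ^ n * deltaSeq (Real.sqrt L) n ^ 2 / L)) =
      1 / (2 ^ n * (n : ℝ) ^ 2) := by
    rw [hδ2, Real.exp_neg, Real.exp_add, one_div]
    congr 2
    · rw [Real.exp_nat_mul, Real.exp_log (by norm_num)]
    · rw [mul_comm, Real.exp_mul, Real.exp_log hn0, Real.rpow_ofNat]
  set A : Fin (2 ^ n) → Set Ω := fun i => {ω | deltaSeq (Real.sqrt L) n ≤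
    |(2 : ℝ) ^ ((n : ℝ) * (2 * H - 3 / 2)) *
      Real.sqrt (blockNormSq (fun t => ∫ s in (0 : ℝ)..t, W s ω) n i) /
        Real.sqrt tauH - 1|} with hA
  have hAi : ∀ i, P (A i) ≤ ENNReal.ofReal (2 * (1 / (2 ^ n * (n : ℝ) ^ 2))) := by
    intro i
    rw [← ofReal_measureReal, ← hexp]
    exact ENNReal.ofReal_le_ofReal (hW.measureReal_blockNorm_le hH htau i.2 hδ)
  calc P _ ≤ P (⋃ i, A i) := by
        refine measure_mono fun ω hω => ?_
        obtain ⟨i, hi⟩ := exists_eq_ciSup_of_finite (f := fun i : Fin (2 ^ n) =>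
          |(2 : ℝ) ^ ((n : ℝ) * (2 * H - 3 / 2)) *
            Real.sqrt (blockNormSq (fun t => ∫ s in (0 : ℝ)..t, W s ω) n i) /
              Real.sqrt tauH - 1|)
        exact Set.mem_iUnion.2 ⟨i, le_of_le_of_eq hω hi.symm⟩
    _ ≤ ∑ i, P (A i) := measure_iUnion_fintype_le _ _
    _ ≤ ∑ _i : Fin (2 ^ n), ENNReal.ofReal (2 * (1 / (2 ^ n * (n : ℝ) ^ 2))) :=
        Finset.sum_le_sum fun i _ => hAi i
    _ = ENNReal.ofReal (2 / (n : ℝ) ^ 2) := by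
        rw [Finset.sum_const, Finset.card_univ, Fintype.card_fin, ← ENNReal.ofReal_nsmul]
        congr 1
        rw [nsmul_eq_mul]
        push_cast
        field_simp
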